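/- Let C ⊆ F_q^n be a linear code of dimension k ≥ 1. If C is MDS (minimum distance n - k + 1) and C' ⊆ F_q^n is any linear code of dimension k' with full support, then dim(C ⋆ C') ≥ min(n, k + k' - 1). -/

import Mathlib

/-- The minimum (Hamming) distance of a linear code. -/
noncomputable def minDist {F : Type*} {ι : Type*} [Fintype ι] [Field F] [DecidableEq F]
    (C : Submodule F (ι → F)) : ℕ :=
  sInf {w | ∃ c ∈ C, c ≠ 0 ∧ hammingNorm c = w}

/-- The star product of two linear codes. -/
def starProd {F : Type*} [Field F] {n : ℕ} (C C' : Submodule F (Fin n → F)) :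
    Submodule F (Fin n → F) :=
  Submodule.span F {v | ∃ c ∈ C, ∃ c' ∈ C', v = c * c'}

/-- MDS: separating property. -/
theorem mds_sep {F : Type*} [Field F] [DecidableEq F] {n : ℕ}
    (C : Submodule F (Fin n → F))
    (hMDS : minDist C = n - Module.finrank F C + 1)
    (T : Finset (Fin n)) (t : Fin n) (ht : t ∉ T) (hT : T.card + 1 ≤ Module.finrank F C) :
    ∃ c ∈ C, (∀ j ∈ T, c j = 0) ∧ c t ≠ 0 := by
  classical
  have hkn : Module.finrank F C ≤ n := by
    have := Submodule.finrank_le C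
    simpa using this
  obtain ⟨S, hTS, hS⟩ := Finset.exists_superset_card_eq (s := insert t T)
    (n := Module.finrank F C) (by rw [Finset.card_insert_of_notMem ht]; exact hT)
    (by simpa using hkn)
  let R : C →ₗ[F] (S → F) := (LinearMap.funLeft F F (Subtype.val : S → Fin n)).comp C.subtype
  have hinj : Function.Injective R := by
    rw [← LinearMap.ker_eq_bot, LinearMap.ker_eq_bot']
    rintro ⟨c, hc⟩ h0
    by_contra hne
    have hne' : c ≠ 0 := fun h => hne (by simp [h])
    have hz : ∀ j ∈ S, c j = 0 := fun j hj => congrFun h0 ⟨j, hj⟩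
    have h1 : minDist C ≤ hammingNorm c := Nat.sInf_le ⟨c, hc, hne', rfl⟩
    have h2 : hammingNorm c ≤ (Sᶜ).card := by
      unfold hammingNorm
      apply Finset.card_le_card
      intro j hj
      simp only [Finset.mem_filter, Finset.mem_compl] at hj ⊢
      exact fun h => hj.2 (hz j h)
    rw [Finset.card_compl, Fintype.card_fin] at h2
    omega
  have hsurj : Function.Surjective R :=
    (LinearMap.injective_iff_surjective_of_finrank_eq_finrank (by simp [hS])).1 hinj
  have htS : t ∈ S := hTS (Finset.mem_insert_self _ _)
  obtain ⟨⟨c, hc⟩, hcR⟩ := hsurj (Pi.single ⟨t, htS⟩ 1)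
  refine ⟨c, hc, fun j hj => ?_, ?_⟩
  · have h := congrFun hcR ⟨j, hTS (Finset.mem_insert_of_mem hj)⟩
    rw [Pi.single_eq_of_ne] at h
    · exact h
    · rintro h'
      exact ht (by cases h'; exact hj)
  · have h := congrFun hcR ⟨t, htS⟩
    rw [Pi.single_eq_same] at h
    change c t = 1 at h
    simp [h]

/-- Existence of an information set. -/
theorem exists_info_set {F : Type*} [Field F] {n : ℕ} (C : Submodule F (Fin n → F)) :
    ∃ I : Finset (Fin n), I.card = Module.finrank F C ∧
      (∀ c ∈ C, (∀ i ∈ I, c i = 0) → c = 0) ∧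
      ∃ g : Fin n → (Fin n → F), (∀ i ∈ I, g i ∈ C ∧ g i i = 1 ∧ ∀ j ∈ I, j ≠ i → g i j = 0) := by
  classical
  let φ : Fin n → Module.Dual F C := fun i => (LinearMap.proj i).comp C.subtype
  obtain ⟨κ, a, ha, hspan, hli⟩ := exists_linearIndependent' F φ
  haveI : Finite κ := Finite.of_injective a ha
  haveI := Fintype.ofFinite κ
  let I : Finset (Fin n) := Finset.univ.image a
  have hIc : I.card = Fintype.card κ := by
    rw [Finset.card_image_of_injective _ ha, Finset.card_univ]
  have hzero : ∀ c ∈ C, (∀ i ∈ I, c i = 0) → c = 0 := by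
    intro c hc h
    ext j
    have hj : φ j ∈ Submodule.span F (Set.range (φ ∘ a)) := by
      rw [hspan]; exact Submodule.subset_span ⟨j, rfl⟩
    have hle : Submodule.span F (Set.range (φ ∘ a)) ≤
        LinearMap.ker (Module.Dual.eval F C ⟨c, hc⟩) := by
      rw [Submodule.span_le]
      rintro _ ⟨x, rfl⟩
      exact h (a x) (Finset.mem_image_of_mem _ (Finset.mem_univ _))
    exact hle hj
  let R : C →ₗ[F] (I → F) := (LinearMap.funLeft F F (Subtype.val : I → Fin n)).comp C.subtype
  have hinj : Function.Injective R := by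
    rw [← LinearMap.ker_eq_bot, LinearMap.ker_eq_bot']
    rintro ⟨c, hc⟩ h0
    have := hzero c hc (fun i hi => congrFun h0 ⟨i, hi⟩)
    simp [this]
  have h1 : Module.finrank F C ≤ I.card := by
    have := LinearMap.finrank_le_finrank_of_injective hinj
    simpa using this
  have h2 : I.card ≤ Module.finrank F C := by
    rw [hIc, ← Subspace.dual_finrank_eq (K := F) (V := C)]
    exact hli.fintype_card_le_finrank
  have hcard := le_antisymm h2 h1
  have hsurj : Function.Surjective R :=
    (LinearMap.injective_iff_surjective_of_finrank_eq_finrank (by simp [hcard])).1 hinj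
  refine ⟨I, hcard, hzero, ?_⟩
  have : ∀ i, ∃ g : Fin n → F, i ∈ I → (g ∈ C ∧ g i = 1 ∧ ∀ j ∈ I, j ≠ i → g j = 0) := by
    intro i
    by_cases hi : i ∈ I
    · obtain ⟨⟨c, hc⟩, hcR⟩ := hsurj (Pi.single ⟨i, hi⟩ 1)
      refine ⟨c, fun _ => ⟨hc, ?_, fun j hj hji => ?_⟩⟩
      · have h := congrFun hcR ⟨i, hi⟩
        rw [Pi.single_eq_same] at h
        exact h
      · have h := congrFun hcR ⟨j, hj⟩
        rw [Pi.single_eq_of_ne (by simpa using hji)] at h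
        exact h
    · exact ⟨0, fun h => absurd h hi⟩
  choose g hg using this
  exact ⟨g, hg⟩

/-- If `C` is MDS of dimension `k ≥ 1` and `C'` is any linear code with full support, then
`dim (C ⋆ C') ≥ min(n, k + k' - 1)`. -/
theorem mds_star_dim_lower_bound {F : Type*} [Field F] [DecidableEq F] {n : ℕ}
    (C C' : Submodule F (Fin n → F))
    (hk : 1 ≤ Module.finrank F C)
    (hMDS : minDist C = n - Module.finrank F C + 1)
    (hfull : ∀ i, ∃ c ∈ C', c i ≠ 0) :
    min n (Module.finrank F C + Module.finrank F C' - 1)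
      ≤ Module.finrank F (starProd C C') := by
  classical
  have hkn' : Module.finrank F C' ≤ n := by
    have := Submodule.finrank_le C'
    simpa using this
  obtain ⟨I, hI, hzero, g, hg⟩ := exists_info_set C'
  obtain ⟨J, hIJ, hJ⟩ := Finset.exists_superset_card_eq (s := I)
    (n := min n (Module.finrank F C + Module.finrank F C' - 1))
    (by rw [hI]; omega) (by simp)
  have hT : (J \ I).card + 1 ≤ Module.finrank F C := by
    rw [Finset.card_sdiff_of_subset hIJ, hJ, hI]; omega
  have key : ∀ j ∈ J, ∃ v ∈ starProd C C', v j ≠ 0 ∧ ∀ l ∈ J, l ≠ j → v l = 0 := by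
    intro j hj
    obtain ⟨i, hi, hij⟩ : ∃ i ∈ I, g i j ≠ 0 := by
      by_contra! hcon
      obtain ⟨c, hc, hcj⟩ := hfull j
      apply hcj
      have h0 : c - ∑ i ∈ I, c i • g i = 0 := by
        apply hzero
        · exact C'.sub_mem hc (C'.sum_mem fun i hi => C'.smul_mem _ (hg i hi).1)
        · intro l hl
          rw [Pi.sub_apply, Finset.sum_apply, Finset.sum_eq_single_of_mem l hl]
          · simp [(hg l hl).2.1]
          · intro b hb hbl
            simp [(hg b hb).2.2 l hl hbl.symm]
      have h1 := congrFun (sub_eq_zero.1 h0) j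
      rw [h1, Finset.sum_apply]
      exact Finset.sum_eq_zero fun i hi => by simp [hcon i hi]
    have hjm : j ∈ insert i (J \ I) := by
      by_cases hjI : j ∈ I
      · by_cases hji : j = i
        · simp [hji]
        · exact absurd ((hg i hi).2.2 j hjI hji) hij
      · simp [hj, hjI]
    obtain ⟨c, hc, hc0, hcj⟩ := mds_sep C hMDS ((insert i (J \ I)).erase j) j
      (Finset.notMem_erase _ _) (by
        rw [Finset.card_erase_of_mem hjm, Finset.card_insert_of_notMem (by simp [hi])]
        omega)
    refine ⟨c * g i, Submodule.subset_span ⟨c, hc, g i, (hg i hi).1, rfl⟩,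
      mul_ne_zero hcj hij, fun l hl hlj => ?_⟩
    rw [Pi.mul_apply]
    by_cases hlm : l ∈ insert i (J \ I)
    · rw [hc0 l (Finset.mem_erase.2 ⟨hlj, hlm⟩), zero_mul]
    · simp only [Finset.mem_insert, Finset.mem_sdiff, not_or, not_and, not_not] at hlm
      rw [(hg i hi).2.2 l (hlm.2 hl) hlm.1, mul_zero]
  rw [← hJ]
  let R : starProd C C' →ₗ[F] (J → F) :=
    (LinearMap.funLeft F F (Subtype.val : J → Fin n)).comp (starProd C C').subtype
  have hR : LinearMap.range R = ⊤ := by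
    rw [eq_top_iff, ← (Pi.basisFun F J).span_eq, Submodule.span_le]
    rintro _ ⟨⟨j, hj⟩, rfl⟩
    obtain ⟨v, hv, hvj, hv0⟩ := key j hj
    refine ⟨(v j)⁻¹ • ⟨v, hv⟩, ?_⟩
    ext ⟨l, hl⟩
    rw [map_smul, Pi.smul_apply, Pi.basisFun_apply]
    change (v j)⁻¹ • v l = _
    by_cases hlj : l = j
    · subst hlj
      rw [Pi.single_eq_same, smul_eq_mul, inv_mul_cancel₀ hvj]
    · rw [Pi.single_eq_of_ne (by simpa using hlj), hv0 l hl hlj, smul_zero]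
  have := LinearMap.finrank_range_le R
  rw [hR] at this
  simpa using this
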